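/- Let k be a field, Γ a finite simple graph on {1,…,n} with clique complex K, d ≥ 0, and suppose the Cartan complex (k⟨K⟩ ⊗_k S, ω) of K has vanishing cohomology H^p = 0 for all p ≠ d+1 (this holds if and only if K is Cohen–Macaulay of dimension d). Then for any surjective function f : [n] → [m], the group cohomology H^q(G_Γ; k[ℤ^m]) vanishes for all q ≤ m − n + d and for all q > d + 1, where k[ℤ^m] carries the G_Γ-action in which v_i acts by multiplication by y_{f(i)}. -/

import Mathlib

attribute [local instance] Classical.propDecidable

noncomputable section

open CategoryTheory

/-! ### Right-angled Artin groups -/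

/-- The defining relators of a right-angled Artin group. -/
def raagRels {n : ℕ} (G : SimpleGraph (Fin n)) : Set (FreeGroup (Fin n)) :=
  {r | ∃ i j : Fin n, G.Adj i j ∧
    r = FreeGroup.of i * FreeGroup.of j * (FreeGroup.of i)⁻¹ * (FreeGroup.of j)⁻¹}

/-- The right-angled Artin group of a finite simple graph on `Fin n`. -/
abbrev RAAG {n : ℕ} (G : SimpleGraph (Fin n)) : Type :=
  PresentedGroup (raagRels G)

/-- The clique complex of a graph. -/
def cliqueComplex {n : ℕ} (Γ : SimpleGraph (Fin n)) : Set (Finset (Fin n)) :=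
  {σ | ∀ i ∈ σ, ∀ j ∈ σ, i ≠ j → Γ.Adj i j}

/-! ### Group cohomology with coefficients in `k[ℤᵐ]` -/

/-- The group algebra `k[ℤᵐ]` of Laurent polynomials. -/
abbrev LaurentRing (k : Type) [CommRing k] (m : ℕ) : Type :=
  AddMonoidAlgebra k (Fin m → ℤ)

/-- Multiplication by the monomial `y^v` on the Laurent ring. -/
def yMul (k : Type) [CommRing k] (m : ℕ) (v : Fin m → ℤ) :
    LaurentRing k m →ₗ[LaurentRing k m] LaurentRing k m :=
  LinearMap.mulLeft (LaurentRing k m) (AddMonoidAlgebra.single v 1)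

/-- The space of inhomogeneous `q`-cochains of `G` with values in `k[ℤᵐ]`. -/
abbrev inhomogCochains (k : Type) [CommRing k] (m : ℕ) (G : Type) (q : ℕ) : Type :=
  (Fin q → G) → LaurentRing k m

variable (k : Type) [Field k] {m : ℕ} {G : Type} [Group G]
  (φ : G →* Multiplicative (Fin m → ℤ))

/-- The differential of the inhomogeneous cochain complex computing group
cohomology, where `g ∈ G` acts on `k[ℤᵐ]` by multiplication by `y^{φ g}`. -/
def inhomogCoD (q : ℕ) :
    inhomogCochains k m G q →ₗ[LaurentRing k m] inhomogCochains k m G (q + 1) :=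
  LinearMap.pi fun g : Fin (q + 1) → G =>
    (yMul k m (Multiplicative.toAdd (φ (g 0)))).comp
        (LinearMap.proj (fun i => g i.succ)) +
    ∑ j : Fin (q + 1),
      ((-1 : ℤ) ^ ((j : ℕ) + 1)) • LinearMap.proj (Fin.contractNth j (· * ·) g)

/-- The cochain differential entering degree `q` (zero for `q = 0`). -/
def inhomogCoDpre : ∀ q : ℕ,
    inhomogCochains k m G (q - 1) →ₗ[LaurentRing k m] inhomogCochains k m G q
  | 0 => 0
  | (q + 1) => inhomogCoD k φ q

/-- The group cohomology `H^q(G; k[ℤᵐ])`. -/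
def groupCohomologyLaurent (q : ℕ) : Type :=
  ↥(Submodule.map (LinearMap.range (inhomogCoDpre k φ q)).mkQ
      (LinearMap.ker (inhomogCoD k φ q)))

instance (q : ℕ) : AddCommGroup (groupCohomologyLaurent k φ q) :=
  inferInstanceAs (AddCommGroup ↥(Submodule.map _ _))

instance (q : ℕ) : Module (LaurentRing k m) (groupCohomologyLaurent k φ q) :=
  inferInstanceAs (Module _ ↥(Submodule.map _ _))

/-! ### The polynomial ring `S` and the Cartan complex -/

/-- The polynomial ring `S = k[t₁,…,tₙ]`. -/
abbrev polyRing (k : Type) [Field k] (n : ℕ) : Type := MvPolynomial (Fin n) k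

/-- The ring homomorphism `S → k[ℤᵐ]`, `tᵢ ↦ y_{f i} - 1`. -/
def phiS (k : Type) [Field k] {n m : ℕ} (f : Fin n → Fin m) :
    polyRing k n →+* LaurentRing k m :=
  (MvPolynomial.eval₂Hom (algebraMap k (LaurentRing k m))
    (fun i => AddMonoidAlgebra.single (Pi.single (f i) 1) 1 - 1))

variable {n : ℕ} (K : Set (Finset (Fin n)))

/-- The degree-`p` term `k⟨K⟩_p ⊗_k S` of the Cartan complex. -/
abbrev cartanTerm (p : ℕ) : Type :=
  {I : Finset (Fin n) // I ∈ K ∧ I.card = p} → polyRing k n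

/-- The Cartan differential, left multiplication by `ω = ∑ eᵢ ⊗ tᵢ`. -/
def cartanD (p : ℕ) : cartanTerm k K p →ₗ[polyRing k n] cartanTerm k K (p + 1) :=
  LinearMap.pi fun J => ∑ i : Fin n,
    if h : i ∈ J.1 ∧ J.1.erase i ∈ K then
      ((-1 : ℤ) ^ (J.1.filter (· < i)).card) •
        ((LinearMap.mulLeft (polyRing k n) (MvPolynomial.X i)).comp
          (LinearMap.proj
            (⟨J.1.erase i, h.2, by
                rw [Finset.card_erase_of_mem h.1, J.2.2, Nat.add_sub_cancel]⟩ :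
              {I : Finset (Fin n) // I ∈ K ∧ I.card = p})))
    else 0

/-- The Cartan differential entering degree `p` (zero for `p = 0`). -/
def cartanDpre : ∀ p : ℕ, cartanTerm k K (p - 1) →ₗ[polyRing k n] cartanTerm k K p
  | 0 => 0
  | (p + 1) => cartanD k K p

/-- The `p`-th cohomology of the Cartan complex `(k⟨K⟩ ⊗_k S, ω)`. -/
def cartanCohomology (p : ℕ) : Type :=
  ↥(Submodule.map (LinearMap.range (cartanDpre k K p)).mkQ
      (LinearMap.ker (cartanD k K p)))

instance (p : ℕ) : AddCommGroup (cartanCohomology k K p) :=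
  inferInstanceAs (AddCommGroup ↥(Submodule.map _ _))

instance (p : ℕ) : Module (polyRing k n) (cartanCohomology k K p) :=
  inferInstanceAs (Module _ ↥(Submodule.map _ _))

/-! ### Koszul-type complexes of a simplicial complex -/

section Koszul

variable {V : Type} [LinearOrder V] [DecidableEq V] {M N : Type} [AddCommGroup M] [AddCommGroup N]

/-- The differential `∑ eᵢ ⊗ Tᵢ` on cochains indexed by finite sets. A cochain is a function on all
finite sets; its values in degree `p` are those on the sets of cardinality `p`. -/
def koszulD (T : V → AddMonoid.End M) (z : Finset V → M) (J : Finset V) : M :=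
  ∑ i ∈ J, (-1 : ℤ) ^ (J.filter (· < i)).card • T i (z (J.erase i))

/-- Exactness in degree `p` of the complex of cochains on the faces of `K` with differential
`∑ eᵢ ⊗ Tᵢ`. -/
def KoszulExactAt (K : Set (Finset V)) (T : V → AddMonoid.End M) (p : ℕ) : Prop :=
  ∀ z : Finset V → M, (∀ J ∈ K, J.card = p + 1 → koszulD T z J = 0) →
    ∃ w : Finset V → M, ∀ J ∈ K, J.card = p → koszulD T w J = z J

theorem koszulD_congr (T : V → AddMonoid.End M) {z w : Finset V → M} {J : Finset V}
    (h : ∀ i ∈ J, z (J.erase i) = w (J.erase i)) : koszulD T z J = koszulD T w J :=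
  Finset.sum_congr rfl fun i hi => by rw [h i hi]

theorem koszulD_add (T : V → AddMonoid.End M) (z w : Finset V → M) (J : Finset V) :
    koszulD T (fun I => z I + w I) J = koszulD T z J + koszulD T w J := by
  simp only [koszulD, map_add, smul_add, Finset.sum_add_distrib]

theorem koszulD_sub (T : V → AddMonoid.End M) (z w : Finset V → M) (J : Finset V) :
    koszulD T (fun I => z I - w I) J = koszulD T z J - koszulD T w J := by
  simp only [koszulD, map_sub, smul_sub, Finset.sum_sub_distrib]

theorem koszulD_zsmul (T : V → AddMonoid.End M) (c : ℤ) (z : Finset V → M) (J : Finset V) :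
    koszulD T (fun I => c • z I) J = c • koszulD T z J := by
  simp only [koszulD, map_zsmul, Finset.smul_sum]
  exact Finset.sum_congr rfl fun i _ => smul_comm _ _ _

theorem koszulD_map {T : V → AddMonoid.End M} {T' : V → AddMonoid.End N} (F : M →+ N)
    (z : Finset V → M) (J : Finset V) (h : ∀ i ∈ J, ∀ x, F (T i x) = T' i (F x)) :
    koszulD T' (fun I => F (z I)) J = F (koszulD T z J) := by
  simp only [koszulD, map_sum, map_zsmul]
  exact Finset.sum_congr rfl fun i hi => by rw [h i hi]

@[simp]
theorem koszulD_empty (T : V → AddMonoid.End M) (z : Finset V → M) : koszulD T z ∅ = 0 := by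
  simp [koszulD]

theorem koszulD_insert_max (T : V → AddMonoid.End M) (z : Finset V → M) {J : Finset V} {v : V}
    (hv : ∀ i ∈ J, i < v) :
    koszulD T z (insert v J) =
      koszulD T (fun I => z (insert v I)) J + (-1 : ℤ) ^ J.card • T v (z J) := by
  have hvJ : v ∉ J := fun h => lt_irrefl _ (hv v h)
  have h1 : (insert v J).filter (· < v) = J := by
    ext i
    simp only [Finset.mem_filter, Finset.mem_insert]
    grind
  rw [koszulD, Finset.sum_insert hvJ, h1, Finset.erase_insert hvJ, add_comm]
  congr 1
  refine Finset.sum_congr rfl fun i hi => ?_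
  have h2 : (insert v J).filter (· < i) = J.filter (· < i) := by
    ext j
    simp only [Finset.mem_filter, Finset.mem_insert]
    have := hv i hi
    grind
  rw [h2, Finset.erase_insert_of_ne (hv i hi).ne']

theorem koszulD_comm (T : V → AddMonoid.End M) (v : V) (z : Finset V → M) (J : Finset V)
    (h : ∀ i ∈ J, ∀ x, T v (T i x) = T i (T v x)) :
    koszulD T (fun I => T v (z I)) J = T v (koszulD T z J) := by
  simp only [koszulD, map_sum, map_zsmul]
  exact Finset.sum_congr rfl fun i hi => by rw [h i hi]

theorem koszulD_koszulD (T : V → AddMonoid.End M) (J : Finset V) (z : Finset V → M)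
    (hT : ∀ i ∈ J, ∀ j ∈ J, ∀ x, T i (T j x) = T j (T i x)) :
    koszulD T (koszulD T z) J = 0 := by
  obtain ⟨c, hc⟩ : ∃ c, J.card = c := ⟨_, rfl⟩
  induction c generalizing J z with
  | zero => rw [Finset.card_eq_zero.1 hc, koszulD_empty]
  | succ c ih =>
    have hne : J.Nonempty := Finset.card_pos.1 (by omega)
    set v := J.max' hne
    have hv : v ∈ J := J.max'_mem hne
    have hlt : ∀ i ∈ J.erase v, i < v := fun i hi =>
      lt_of_le_of_ne (J.le_max' i (Finset.mem_of_mem_erase hi)) (Finset.ne_of_mem_erase hi)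
    have hcard : (J.erase v).card = c := by rw [Finset.card_erase_of_mem hv, hc, Nat.add_sub_cancel]
    have hsub : ∀ i ∈ J.erase v, i ∈ J := fun i hi => Finset.mem_of_mem_erase hi
    have key : koszulD T (fun I => koszulD T z (insert v I)) (J.erase v) =
        koszulD T (fun I => koszulD T (fun I => z (insert v I)) I +
          (-1 : ℤ) ^ (c - 1) • T v (z I)) (J.erase v) := by
      refine koszulD_congr T fun i hi => ?_
      rw [koszulD_insert_max T z fun j hj => hlt j (Finset.mem_of_mem_erase hj),
        Finset.card_erase_of_mem hi, hcard]
    rw [← Finset.insert_erase hv, koszulD_insert_max T _ hlt, key, koszulD_add,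
      ih _ _ (fun i hi j hj => hT i (hsub i hi) j (hsub j hj)) hcard, koszulD_zsmul,
      koszulD_comm T v z _ fun i hi x => hT v hv i (hsub i hi) x, hcard, zero_add]
    rcases c with _ | c
    · rw [Finset.card_eq_zero.1 hcard]
      simp
    · simp [pow_succ]

end Koszul

/-! ### Acyclicity of coinduced modules -/

section Coinduced

variable {k : Type} [CommRing k] {G : Type} [Group G] {M : Type} [AddCommGroup M] [Module k M]

/-- The operator `ρ g - 1`. -/
def repSubOne (ρ : Representation k G M) (g : G) : AddMonoid.End M :=
  ((ρ g).toAddMonoidHom - AddMonoidHom.id M : M →+ M)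

theorem repSubOne_apply (ρ : Representation k G M) (g : G) (x : M) :
    repSubOne ρ g x = ρ g x - x := rfl

theorem repSubOne_comm (ρ : Representation k G M) {g h : G} (hgh : Commute g h) (x : M) :
    repSubOne ρ g (repSubOne ρ h x) = repSubOne ρ h (repSubOne ρ g x) := by
  have : ρ g (ρ h x) = ρ h (ρ g x) := by
    rw [← Module.End.mul_apply, ← Module.End.mul_apply, ← map_mul, ← map_mul, hgh.eq]
  simp only [repSubOne_apply, map_sub, this]
  abel

variable (k G M) in
/-- The coinduced representation on `G → M`, by left translation. -/
def translationRep : Representation k G (G → M) where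
  toFun h := LinearMap.funLeft k M (fun x => h⁻¹ * x)
  map_one' := by
    ext F x
    simp [LinearMap.funLeft_apply]
  map_mul' g h := by
    ext F x
    simp [LinearMap.funLeft_apply, mul_assoc]

@[simp]
theorem translationRep_apply (h : G) (F : G → M) (x : G) :
    translationRep k G M h F x = F (h⁻¹ * x) := rfl

end Coinduced

section RAAG

variable {n : ℕ} {Γ : SimpleGraph (Fin n)}

theorem cliqueComplex_erase :
    ∀ J ∈ cliqueComplex Γ, ∀ i ∈ J, J.erase i ∈ cliqueComplex Γ :=
  fun _ hJ _ _ a ha b hb => hJ a (Finset.mem_of_mem_erase ha) b (Finset.mem_of_mem_erase hb)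

theorem raag_commute_of {i j : Fin n} (h : Γ.Adj i j) :
    Commute (PresentedGroup.of i : RAAG Γ) (PresentedGroup.of j) := by
  have : PresentedGroup.mk (raagRels Γ) _ = 1 := PresentedGroup.one_of_mem ⟨i, j, h, rfl⟩
  simp only [map_mul, map_inv] at this
  rw [mul_inv_eq_one, mul_inv_eq_iff_eq_mul] at this
  exact this

/-- The homomorphism out of a right-angled Artin group given by commuting images of adjacent
generators. -/
def raagLift {H : Type} [Group H] (F : Fin n → H) (hF : ∀ i j, Γ.Adj i j → Commute (F i) (F j)) :
    RAAG Γ →* H :=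
  PresentedGroup.toGroup (f := F) (by
    rintro r ⟨i, j, hij, rfl⟩
    simp only [map_mul, map_inv, FreeGroup.lift_apply_of]
    rw [mul_inv_eq_one, mul_inv_eq_iff_eq_mul]
    exact hF i j hij)

@[simp]
theorem raagLift_of {H : Type} [Group H] (F : Fin n → H)
    (hF : ∀ i j, Γ.Adj i j → Commute (F i) (F j)) (i : Fin n) :
    raagLift F hF (PresentedGroup.of i : RAAG Γ) = F i :=
  PresentedGroup.toGroup.of _

/-- The retraction of a right-angled Artin group onto the subgroup generated by the vertices
in `W`. -/
def raagRetract (Γ : SimpleGraph (Fin n)) (W : Finset (Fin n)) : RAAG Γ →* RAAG Γ :=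
  raagLift (fun i => if i ∈ W then PresentedGroup.of i else 1) (by
    intro i j hij
    split_ifs
    · exact raag_commute_of hij
    all_goals simp)

theorem raagRetract_of {W : Finset (Fin n)} {i : Fin n} (hi : i ∈ W) :
    raagRetract Γ W (PresentedGroup.of i) = PresentedGroup.of i := by
  simp [raagRetract, hi]

theorem raagRetract_idem (W : Finset (Fin n)) (x : RAAG Γ) :
    raagRetract Γ W (raagRetract Γ W x) = raagRetract Γ W x := by
  have : (raagRetract Γ W).comp (raagRetract Γ W) = raagRetract Γ W := by
    refine PresentedGroup.ext fun i => ?_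
    by_cases hi : i ∈ W <;> simp [raagRetract, hi]
  exact DFunLike.congr_fun this x

/-- The affine permutation `(x, a) ↦ (g x, a - c (g x))`. -/
def affinePerm {G A : Type} [Group G] [AddCommGroup A] (g : G) (c : G → A) :
    Equiv.Perm (G × A) where
  toFun p := (g * p.1, p.2 - c (g * p.1))
  invFun p := (g⁻¹ * p.1, p.2 + c p.1)
  left_inv p := by simp
  right_inv p := by simp

theorem affinePerm_commute {G A : Type} [Group G] [AddCommGroup A] {g h : G} {c e : G → A}
    (hgh : Commute g h) (hc : ∀ x, e (g⁻¹ * x) - e x = c (h⁻¹ * x) - c x) :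
    Commute (affinePerm g c) (affinePerm h e) := by
  refine Equiv.ext fun p => ?_
  have h1 : g * (h * p.1) = h * (g * p.1) := by rw [← mul_assoc, hgh.eq, mul_assoc]
  have h2 := hc (g * (h * p.1))
  rw [inv_mul_cancel_left] at h2
  rw [h1, inv_mul_cancel_left] at h2
  simp only [Equiv.Perm.mul_apply, affinePerm, Equiv.coe_fn_mk, h1, Prod.mk.injEq, true_and]
  rw [sub_eq_sub_iff_add_eq_add] at h2
  rw [sub_sub, sub_sub, h2, add_comm]

/-- Crossed homomorphisms on the subgroup generated by `W` with coinduced values are principal. -/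
theorem exists_translation_primitive {A : Type} [AddCommGroup A] (W : Finset (Fin n))
    (c : Fin n → RAAG Γ → A)
    (hc : ∀ i ∈ W, ∀ j ∈ W, Γ.Adj i j → ∀ x,
      c j ((PresentedGroup.of i)⁻¹ * x) - c j x = c i ((PresentedGroup.of j)⁻¹ * x) - c i x) :
    ∃ F : RAAG Γ → A, ∀ i ∈ W, ∀ x, F ((PresentedGroup.of i)⁻¹ * x) - F x = c i x := by
  let θ : RAAG Γ →* Equiv.Perm (RAAG Γ × A) :=
    raagLift (fun i => if i ∈ W then affinePerm (PresentedGroup.of i) (c i) else 1) (by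
      intro i j hij
      split_ifs with hi hj
      · exact affinePerm_commute (raag_commute_of hij) (hc i hi j hj hij)
      all_goals simp)
  have hθ : ∀ i ∈ W, θ (PresentedGroup.of i) = affinePerm (PresentedGroup.of i) (c i) := by
    intro i hi
    simp [θ, hi]
  have hfst : ∀ g p, (θ g p).1 = raagRetract Γ W g * p.1 := by
    intro g
    refine PresentedGroup.generated_by (raagRels Γ)
      { carrier := {g | ∀ p, (θ g p).1 = raagRetract Γ W g * p.1}
        one_mem' := by simp
        mul_mem' := by
          intro a b ha hb p
          rw [map_mul, Equiv.Perm.mul_apply, ha, hb, map_mul, mul_assoc]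
        inv_mem' := by
          intro a ha p
          have := ha (θ a⁻¹ p)
          rw [← Equiv.Perm.mul_apply, ← map_mul, mul_inv_cancel, map_one,
            Equiv.Perm.one_apply] at this
          rw [this, map_inv, map_inv, inv_mul_cancel_left] } (fun j p => ?_) g
    by_cases hj : j ∈ W
    · rw [hθ j hj, raagRetract_of hj]
      rfl
    · simp [θ, raagRetract, hj]
  let s := QuotientGroup.rightRel (raagRetract Γ W).range
  let rep : RAAG Γ → RAAG Γ := fun x => (Quotient.mk s x).out
  have hrep : ∀ x, x * (rep x)⁻¹ ∈ (raagRetract Γ W).range := fun x =>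
    QuotientGroup.rightRel_apply.1 (Quotient.mk_out (s := s) x)
  have hfix : ∀ x, raagRetract Γ W (x * (rep x)⁻¹) = x * (rep x)⁻¹ := by
    intro x
    obtain ⟨y, hy⟩ := hrep x
    rw [← hy, raagRetract_idem]
  have hinv : ∀ i ∈ W, ∀ x, rep (PresentedGroup.of i * x) = rep x := by
    intro i hi x
    refine congrArg Quotient.out (Quotient.sound (s := s) (QuotientGroup.rightRel_apply.2 ?_))
    rw [mul_inv_rev, mul_inv_cancel_left]
    exact inv_mem ⟨_, raagRetract_of hi⟩
  let F : RAAG Γ → A := fun x => (θ (x * (rep x)⁻¹) (rep x, 0)).2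
  have hpt : ∀ x, θ (x * (rep x)⁻¹) (rep x, 0) = (x, F x) := fun x =>
    Prod.ext (by rw [hfst, hfix, inv_mul_cancel_right]) rfl
  refine ⟨F, fun i hi x => ?_⟩
  have key : ∀ y, F (PresentedGroup.of i * y) = F y - c i (PresentedGroup.of i * y) := by
    intro y
    have : F (PresentedGroup.of i * y) =
        (θ (PresentedGroup.of i * y * (rep y)⁻¹) (rep y, 0)).2 := by
      simp only [F, hinv i hi y]
    rw [this, mul_assoc, map_mul, Equiv.Perm.mul_apply, hpt, hθ i hi]
    rfl
  have := key ((PresentedGroup.of i)⁻¹ * x)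
  rw [mul_inv_cancel_left] at this
  rw [this]
  abel

/-- The operators `ρ vᵢ - 1` of a representation of a right-angled Artin group. -/
def raagOp {k M : Type} [CommRing k] [AddCommGroup M] [Module k M]
    (ρ : Representation k (RAAG Γ) M) (i : Fin n) : AddMonoid.End M :=
  repSubOne ρ (PresentedGroup.of i)

theorem raagOp_apply {k M : Type} [CommRing k] [AddCommGroup M] [Module k M]
    (ρ : Representation k (RAAG Γ) M) (i : Fin n) (x : M) :
    raagOp ρ i x = ρ (PresentedGroup.of i) x - x := rfl

theorem raagOp_comm {k M : Type} [CommRing k] [AddCommGroup M] [Module k M]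
    (ρ : Representation k (RAAG Γ) M) {J : Finset (Fin n)} (hJ : J ∈ cliqueComplex Γ) :
    ∀ i ∈ J, ∀ j ∈ J, ∀ x, raagOp ρ i (raagOp ρ j x) = raagOp ρ j (raagOp ρ i x) := by
  intro i hi j hj x
  by_cases hij : i = j
  · rw [hij]
  · exact repSubOne_comm ρ (raag_commute_of (hJ i hi j hj hij)) x

theorem koszulExactAt_translationRep_one (k A : Type) [CommRing k] [AddCommGroup A] [Module k A]
    (W : Finset (Fin n)) :
    KoszulExactAt {J ∈ cliqueComplex Γ | J ⊆ W} (raagOp (translationRep k (RAAG Γ) A)) 1 := by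
  intro z hz
  have hlt : ∀ i ∈ W, ∀ j ∈ W, Γ.Adj i j → i < j → ∀ x,
      z {j} ((PresentedGroup.of i)⁻¹ * x) - z {j} x =
        z {i} ((PresentedGroup.of j)⁻¹ * x) - z {i} x := by
    intro i hi j hj hij hlt x
    have h := hz (insert j {i}) ⟨?_, ?_⟩ ?_
    · rw [koszulD_insert_max _ _ (by simpa using hlt)] at h
      have h1 := congrFun h x
      have h2 : ({i} : Finset (Fin n)) = insert i ∅ := by simp
      rw [h2, koszulD_insert_max _ _ (by simp), koszulD_empty] at h1
      simp [raagOp_apply] at h1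
      grind
    · intro a ha b hb hab
      simp only [Finset.mem_insert, Finset.mem_singleton] at ha hb
      rcases ha with rfl | rfl <;> rcases hb with rfl | rfl
      · exact absurd rfl hab
      · exact hij.symm
      · exact hij
      · exact absurd rfl hab
    · intro a ha
      simp only [Finset.mem_insert, Finset.mem_singleton] at ha
      rcases ha with rfl | rfl <;> assumption
    · rw [Finset.card_insert_of_notMem (by simpa using hlt.ne'), Finset.card_singleton]
  obtain ⟨F, hF⟩ := exists_translation_primitive W (fun i => z {i}) (by
    intro i hi j hj hij x
    rcases lt_or_gt_of_ne hij.ne with h | h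
    · exact hlt i hi j hj hij h x
    · exact (hlt j hj i hi hij.symm h x).symm)
  refine ⟨fun _ => F, fun J hJ hJ1 => ?_⟩
  obtain ⟨i, rfl⟩ := Finset.card_eq_one.1 hJ1
  have h2 : ({i} : Finset (Fin n)) = insert i ∅ := by simp
  ext x
  have := hF i (hJ.2 (by simp)) x
  rw [← this]
  conv_lhs => rw [h2]
  rw [koszulD_insert_max _ _ (by simp), koszulD_empty]
  simp [raagOp_apply]

theorem koszulExactAt_translationRep (k A : Type) [CommRing k] [AddCommGroup A] [Module k A]
    (W : Finset (Fin n)) (p : ℕ) :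
    KoszulExactAt {J ∈ cliqueComplex Γ | J ⊆ W} (raagOp (translationRep k (RAAG Γ) A)) (p + 1) := by
  obtain ⟨c, hc⟩ : ∃ c, W.card = c := ⟨_, rfl⟩
  induction c using Nat.strong_induction_on generalizing W p with
  | _ c ih =>
  rcases p with _ | p
  · exact koszulExactAt_translationRep_one k A W
  intro z hz
  rcases W.eq_empty_or_nonempty with rfl | hne
  · refine ⟨z, fun J hJ hJp => ?_⟩
    rw [Finset.subset_empty.1 hJ.2] at hJp
    simp at hJp
  set T := raagOp (translationRep k (RAAG Γ) A) with hT
  set v := W.max' hne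
  have hv : v ∈ W := W.max'_mem hne
  have hmax : ∀ i ∈ W, i ≠ v → i < v := fun i hi h => lt_of_le_of_ne (W.le_max' i hi) h
  have hcard : (W.erase v).card < c := hc ▸ Finset.card_erase_lt_of_mem hv
  have hcard' : ((W.erase v).filter (Γ.Adj v)).card < c :=
    (Finset.card_filter_le _ _).trans_lt hcard
  obtain ⟨w, hw⟩ := ih _ hcard (W.erase v) (p + 1) rfl z fun J hJ hJp =>
    hz J ⟨hJ.1, hJ.2.trans (Finset.erase_subset _ _)⟩ hJp
  let w' : Finset (Fin n) → RAAG Γ → A := fun J => if v ∈ J then 0 else w J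
  have hw' : ∀ J ∈ cliqueComplex Γ, J ⊆ W.erase v → J.card = p + 2 → koszulD T w' J = z J := by
    intro J hJ hJW hJp
    rw [← hw J ⟨hJ, hJW⟩ hJp]
    refine koszulD_congr T fun i _ => if_neg fun h => ?_
    exact (Finset.mem_erase.1 (hJW (Finset.mem_of_mem_erase h))).1 rfl
  -- faces of the link of `v`
  have hlink : ∀ J ∈ cliqueComplex Γ, J ⊆ (W.erase v).filter (Γ.Adj v) →
      insert v J ∈ cliqueComplex Γ ∧ insert v J ⊆ W ∧ (∀ i ∈ J, i < v) ∧ J ⊆ W.erase v ∧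
        (insert v J).card = J.card + 1 := by
    intro J hJ hJL
    have hadj : ∀ i ∈ J, Γ.Adj v i := fun i hi => (Finset.mem_filter.1 (hJL hi)).2
    have hsub : J ⊆ W.erase v := hJL.trans (Finset.filter_subset _ _)
    have hlt : ∀ i ∈ J, i < v := fun i hi =>
      hmax i (Finset.mem_of_mem_erase (hsub hi)) (Finset.ne_of_mem_erase (hsub hi))
    refine ⟨?_, ?_, hlt, hsub, Finset.card_insert_of_notMem fun h => lt_irrefl _ (hlt v h)⟩
    · intro a ha b hb hab
      rcases Finset.mem_insert.1 ha with rfl | ha' <;> rcases Finset.mem_insert.1 hb with rfl | hb'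
      · exact absurd rfl hab
      · exact hadj b hb'
      · exact (hadj a ha').symm
      · exact hJ a ha' b hb' hab
    · exact Finset.insert_subset hv (hsub.trans (Finset.erase_subset _ _))
  obtain ⟨u, hu⟩ := ih _ hcard' ((W.erase v).filter (Γ.Adj v)) p rfl
    (fun J => z (insert v J) - koszulD T w' (insert v J)) (by
      intro J hJ hJp
      obtain ⟨h1, h2, h3, h4, h5⟩ := hlink J hJ.1 hJ.2
      have e1 := koszulD_sub T z (koszulD T w') (insert v J)
      rw [hz _ ⟨h1, h2⟩ (by omega), koszulD_koszulD T _ _ (raagOp_comm _ h1), sub_zero,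
        koszulD_insert_max T _ h3, hw' J hJ.1 h4 hJp, sub_self, map_zero, smul_zero,
        add_zero] at e1
      exact e1)
  refine ⟨fun J => if v ∈ J then u (J.erase v) else w J, fun J hJ hJp => ?_⟩
  by_cases hvJ : v ∈ J
  · have hJ' : J.erase v ∈ cliqueComplex Γ := cliqueComplex_erase J hJ.1 v hvJ
    have hL : J.erase v ⊆ (W.erase v).filter (Γ.Adj v) := by
      intro i hi
      obtain ⟨hi1, hi2⟩ := Finset.mem_erase.1 hi
      exact Finset.mem_filter.2 ⟨Finset.mem_erase.2 ⟨hi1, hJ.2 hi2⟩, hJ.1 v hvJ i hi2 hi1.symm⟩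
    obtain ⟨h1, h2, h3, h4, h5⟩ := hlink _ hJ' hL
    have hcJ : (J.erase v).card = p + 1 := by
      rw [Finset.card_erase_of_mem hvJ, hJp, Nat.add_sub_cancel]
    have hvJ' : v ∉ J.erase v := Finset.notMem_erase v J
    have e1 := hu _ ⟨hJ', hL⟩ hcJ
    rw [Finset.insert_erase hvJ] at e1
    have e2 : koszulD T w' J = (-1 : ℤ) ^ (J.erase v).card • T v (w (J.erase v)) := by
      conv_lhs => rw [← Finset.insert_erase hvJ]
      rw [koszulD_insert_max T _ h3]
      simp only [w', if_neg hvJ']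
      simp [koszulD]
    conv_lhs => rw [← Finset.insert_erase hvJ]
    rw [koszulD_insert_max T _ h3, if_neg hvJ', ← e2, ← sub_add_cancel (z J) (koszulD T w' J), ← e1]
    congr 1
    refine koszulD_congr T fun i hi => ?_
    simp [Finset.erase_insert (fun h => hvJ' (Finset.mem_of_mem_erase h) :
      v ∉ (J.erase v).erase i)]
  · have hJW : J ⊆ W.erase v := fun i hi =>
      Finset.mem_erase.2 ⟨fun h => hvJ (h ▸ hi), hJ.2 hi⟩
    rw [← hw J ⟨hJ.1, hJW⟩ hJp]
    exact koszulD_congr T fun i _ => if_neg fun h => hvJ (Finset.mem_of_mem_erase h)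

end RAAG

/-! ### Dimension shifting -/

section DimensionShift

theorem KoszulExactAt.of_shortExact {V M F Q : Type} [LinearOrder V] [DecidableEq V]
    [AddCommGroup M] [AddCommGroup F] [AddCommGroup Q] {K : Set (Finset V)}
    {T : V → AddMonoid.End M} {T' : V → AddMonoid.End F} {T'' : V → AddMonoid.End Q}
    (ι : M →+ F) (π : F →+ Q) (hι : Function.Injective ι) (hπ : Function.Surjective π)
    (hιπ : ∀ y, π y = 0 ↔ ∃ x, ι x = y)
    (hT : ∀ i x, ι (T i x) = T' i (ι x)) (hT' : ∀ i x, π (T' i x) = T'' i (π x))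
    (hK : ∀ J ∈ K, ∀ i ∈ J, J.erase i ∈ K)
    (hcomm : ∀ J ∈ K, ∀ i ∈ J, ∀ j ∈ J, ∀ x, T' i (T' j x) = T' j (T' i x))
    {p : ℕ} (hF : KoszulExactAt K T' p) (hM : KoszulExactAt K T (p + 1)) :
    KoszulExactAt K T'' p := by
  intro z hz
  choose σ hσ using hπ
  set z' : Finset V → F := fun J => σ (z J)
  have hz' : z = fun J => π (z' J) := funext fun J => (hσ _).symm
  have hex : ∀ J, ∃ x, J ∈ K → J.card = p + 1 → ι x = koszulD T' z' J := by
    intro J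
    by_cases hJ : J ∈ K ∧ J.card = p + 1
    · have h := hz J hJ.1 hJ.2
      rw [hz', koszulD_map π z' J fun i _ x => hT' i x] at h
      obtain ⟨x, hx⟩ := (hιπ _).1 h
      exact ⟨x, fun _ _ => hx⟩
    · exact ⟨0, fun h1 h2 => absurd ⟨h1, h2⟩ hJ⟩
  choose t ht using hex
  obtain ⟨s, hs⟩ := hM t fun J hJ hJp => by
    apply hι
    rw [← koszulD_map ι t J fun i _ x => hT i x, map_zero,
      ← koszulD_koszulD T' J z' (hcomm J hJ)]
    refine koszulD_congr T' fun i hi => ht _ (hK J hJ i hi) ?_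
    rw [Finset.card_erase_of_mem hi, hJp, Nat.add_sub_cancel]
  obtain ⟨u, hu⟩ := hF (fun J => z' J - ι (s J)) fun J hJ hJp => by
    rw [koszulD_sub, koszulD_map ι s J fun i _ x => hT i x, hs J hJ hJp, ht J hJ hJp, sub_self]
  refine ⟨fun J => π (u J), fun J hJ hJp => ?_⟩
  rw [koszulD_map π u J fun i _ x => hT' i x, hu J hJ hJp, map_sub, (hιπ _).2 ⟨_, rfl⟩, sub_zero,
    hz']

variable {k G : Type} [CommRing k] [Group G] {M F Q : Type} [AddCommGroup M] [Module k M]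
  [AddCommGroup F] [Module k F] [AddCommGroup Q] [Module k Q]

/-- The differential on inhomogeneous cochains with values in a representation. -/
def barD (ρ : Representation k G M) (q : ℕ) (z : (Fin q → G) → M) (g : Fin (q + 1) → G) : M :=
  ρ (g 0) (z fun i => g i.succ) +
    ∑ j : Fin (q + 1), (-1 : ℤ) ^ ((j : ℕ) + 1) • z (Fin.contractNth j (· * ·) g)

/-- Vanishing of cohomology in degree `q`, on inhomogeneous cochains. -/
def BarExactAt (ρ : Representation k G M) : ℕ → Prop
  | 0 => ∀ z, barD ρ 0 z = 0 → z = 0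
  | q + 1 => ∀ z, barD ρ (q + 1) z = 0 → ∃ w, barD ρ q w = z

theorem barD_sub (ρ : Representation k G M) (q : ℕ) (z w : (Fin q → G) → M) :
    barD ρ q (z - w) = barD ρ q z - barD ρ q w := by
  ext g
  simp only [barD, Pi.sub_apply, map_sub, smul_sub, Finset.sum_sub_distrib]
  abel

theorem barD_map {ρ : Representation k G M} {τ : Representation k G F} (L : M →ₗ[k] F)
    (hL : ∀ g x, L (ρ g x) = τ g (L x)) (q : ℕ) (z : (Fin q → G) → M) (g : Fin (q + 1) → G) :
    barD τ q (fun h => L (z h)) g = L (barD ρ q z g) := by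
  simp only [barD, map_add, map_sum, map_zsmul, hL]

theorem barD_eq_d (ρ : Representation k G M) (q : ℕ) (z : (Fin q → G) → M) :
    barD ρ q z = (inhomogeneousCochains.d (Rep.of ρ) q).hom z := by
  ext g
  rw [inhomogeneousCochains.d_hom_apply]
  refine congrArg (ρ (g 0) (z fun i => g i.succ) + ·) (Finset.sum_congr rfl fun j _ => ?_)
  rcases neg_one_pow_eq_or ℤ ((j : ℕ) + 1) with h | h <;>
    rcases Nat.even_or_odd ((j : ℕ) + 1) with h' | h' <;>
    simp [h'.neg_one_pow]

theorem barD_barD (ρ : Representation k G M) (q : ℕ) (z : (Fin q → G) → M) :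
    barD ρ (q + 1) (barD ρ q z) = 0 := by
  rw [barD_eq_d, barD_eq_d]
  have h := groupCohomology.inhomogeneousCochains.d_comp_d q (Rep.of ρ)
  exact LinearMap.congr_fun (congrArg ModuleCat.Hom.hom h) z

theorem BarExactAt.of_shortExact {ρ : Representation k G M} {τ : Representation k G F}
    {υ : Representation k G Q} (ι : M →ₗ[k] F) (π : F →ₗ[k] Q) (hι : Function.Injective ι)
    (hπ : Function.Surjective π) (hιπ : ∀ y, π y = 0 ↔ ∃ x, ι x = y)
    (hρ : ∀ g x, ι (ρ g x) = τ g (ι x)) (hτ : ∀ g x, π (τ g x) = υ g (π x)) {q : ℕ}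
    (hF : BarExactAt τ (q + 2)) (hQ : BarExactAt υ (q + 1)) : BarExactAt ρ (q + 2) := by
  intro z hz
  obtain ⟨w, hw⟩ := hF (fun g => ι (z g)) (by
    ext g
    rw [barD_map ι hρ, hz, Pi.zero_apply, map_zero, Pi.zero_apply])
  obtain ⟨u, hu⟩ := hQ (fun g => π (w g)) (by
    ext g
    rw [barD_map π hτ, hw, (hιπ _).2 ⟨_, rfl⟩, Pi.zero_apply])
  choose σ hσ using hπ
  have hex : ∀ g, ∃ x, ι x = w g - barD τ q (fun h => σ (u h)) g := by
    intro g
    rw [← hιπ, map_sub, ← barD_map π hτ]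
    simp only [hσ, hu, sub_self]
  choose t ht using hex
  refine ⟨t, funext fun g => hι ?_⟩
  rw [← barD_map ι hρ, funext ht]
  have := congrFun (barD_sub τ (q + 1) w (barD τ q fun h => σ (u h))) g
  rw [hw, barD_barD, sub_zero] at this
  exact this

theorem barExactAt_translationRep (q : ℕ) : BarExactAt (translationRep k G M) (q + 1) := by
  intro z hz
  refine ⟨fun g x => z (Fin.cons x⁻¹ g) 1, ?_⟩
  ext g x
  have h := congrFun (congrFun hz (Fin.cons x⁻¹ g)) 1
  have h0 : Fin.contractNth 0 (· * ·) (Fin.cons x⁻¹ g : Fin (q + 2) → G) =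
      Fin.cons (x⁻¹ * g 0) fun i => g i.succ := by
    ext i
    refine Fin.cases ?_ (fun i => ?_) i
    · simp [Fin.contractNth]
    · simp [Fin.contractNth]
  have h1 : ∀ j : Fin (q + 1), Fin.contractNth j.succ (· * ·) (Fin.cons x⁻¹ g : Fin (q + 2) → G) =
      Fin.cons x⁻¹ (Fin.contractNth j (· * ·) g) := by
    intro j
    ext i
    refine Fin.cases ?_ (fun i => ?_) i
    · simp [Fin.contractNth]
    · simp [Fin.contractNth]
  rw [barD, Fin.sum_univ_succ] at h
  simp only [h0, h1, Fin.cons_zero, Fin.cons_succ, Pi.add_apply, Finset.sum_apply, Pi.smul_apply,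
    Pi.zero_apply, translationRep_apply, inv_inv, mul_one, Fin.val_zero, Fin.val_succ] at h
  simp only [barD, Pi.add_apply, Finset.sum_apply, Pi.smul_apply, translationRep_apply,
    mul_inv_rev, inv_inv]
  simp only [pow_succ _ (_ + 1), mul_neg, mul_one, neg_smul, Finset.sum_neg_distrib] at h
  simp at h ⊢
  grind

variable (ρ : Representation k G M)

/-- The embedding of a representation into a coinduced one. -/
def toTranslation : M →ₗ[k] (G → M) := LinearMap.pi fun x => ρ x⁻¹

theorem toTranslation_apply (m : M) (x : G) : toTranslation ρ m x = ρ x⁻¹ m := rfl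

theorem toTranslation_injective : Function.Injective (toTranslation ρ) := by
  intro a b h
  simpa [toTranslation_apply] using congrFun h 1

theorem toTranslation_rep (g : G) (m : M) :
    toTranslation ρ (ρ g m) = translationRep k G M g (toTranslation ρ m) := by
  ext x
  rw [translationRep_apply, toTranslation_apply, toTranslation_apply, mul_inv_rev, inv_inv, map_mul,
    Module.End.mul_apply]

/-- The cokernel of the embedding of a representation into a coinduced one. -/
def translationQuotient : Representation k G ((G → M) ⧸ LinearMap.range (toTranslation ρ)) where
  toFun g := Submodule.mapQ _ _ (translationRep k G M g) (by
    rintro _ ⟨m, rfl⟩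
    exact ⟨ρ g m, toTranslation_rep ρ g m⟩)
  map_one' := by
    ext F
    simp
  map_mul' g h := by
    ext F
    simp

theorem translationQuotient_mk (g : G) (F : G → M) :
    (LinearMap.range (toTranslation ρ)).mkQ (translationRep k G M g F) =
      translationQuotient ρ g ((LinearMap.range (toTranslation ρ)).mkQ F) := rfl

end DimensionShift

theorem barExactAt_zero_of_koszulExactAt {n : ℕ} {Γ : SimpleGraph (Fin n)} {k M : Type} [CommRing k]
    [AddCommGroup M] [Module k M] (ρ : Representation k (RAAG Γ) M)
    (h : KoszulExactAt (cliqueComplex Γ) (raagOp ρ) 0) : BarExactAt ρ 0 := by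
  intro z hz
  obtain ⟨w, hw⟩ := h (fun _ => z Fin.elim0) (by
    intro J hJ hJ1
    obtain ⟨i, rfl⟩ := Finset.card_eq_one.1 hJ1
    have := congrFun hz (fun _ => PresentedGroup.of i)
    simp only [barD, Fin.sum_univ_succ, Fin.sum_univ_zero] at this
    simp only [koszulD, Finset.sum_singleton, raagOp_apply]
    simp only [Subsingleton.elim _ (Fin.elim0 : Fin 0 → RAAG Γ)] at this
    simpa [sub_eq_add_neg, Finset.filter_singleton] using this)
  have := hw ∅ (by simp [cliqueComplex]) rfl
  rw [koszulD_empty] at this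
  ext g
  rw [Subsingleton.elim g Fin.elim0, ← this]
  rfl

theorem barExactAt_one_of_koszulExactAt {n : ℕ} {Γ : SimpleGraph (Fin n)} {k M : Type} [CommRing k]
    [AddCommGroup M] [Module k M] (ρ : Representation k (RAAG Γ) M)
    (h : KoszulExactAt (cliqueComplex Γ) (raagOp ρ) 1) : BarExactAt ρ 1 := by
  intro z hz
  set c : RAAG Γ → M := fun a => z fun _ => a
  have hc : ∀ a b, c (a * b) = ρ a (c b) + c a := by
    intro a b
    have := congrFun hz ![a, b]
    have e0 : Fin.contractNth 0 (· * ·) ![a, b] = fun _ => a * b := by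
      ext i
      fin_cases i
      rfl
    have e1 : Fin.contractNth 1 (· * ·) ![a, b] = fun _ => a := by
      ext i
      fin_cases i
      rfl
    have e2 : (fun i : Fin 1 => ![a, b] i.succ) = fun _ => b := by
      ext i
      fin_cases i
      rfl
    simp only [barD, e2] at this
    simp at this
    rw [e0, e1] at this
    grind
  obtain ⟨w, hw⟩ := h (fun J => ∑ i ∈ J, c (PresentedGroup.of i)) (by
    intro J hJ hJ2
    obtain ⟨i, j, hij, rfl⟩ : ∃ i j, i < j ∧ J = insert j {i} := by
      obtain ⟨i, j, hij, rfl⟩ := Finset.card_eq_two.1 hJ2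
      rcases lt_or_gt_of_ne hij with h | h
      · exact ⟨i, j, h, Finset.pair_comm _ _⟩
      · exact ⟨j, i, h, rfl⟩
    have h1 := raag_commute_of (hJ i (by simp) j (by simp) hij.ne)
    have h2 := hc (PresentedGroup.of i) (PresentedGroup.of j)
    rw [h1.eq, hc] at h2
    have h3 : ({i} : Finset (Fin n)) = insert i ∅ := by simp
    rw [koszulD_insert_max _ _ (by simpa using hij)]
    conv_lhs => rw [h3]
    rw [koszulD_insert_max _ _ (by simp), koszulD_empty]
    simp [raagOp_apply]
    grind)
  have hgen : ∀ i, c (PresentedGroup.of i) = ρ (PresentedGroup.of i) (w ∅) - w ∅ := by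
    intro i
    have h3 : ({i} : Finset (Fin n)) = insert i ∅ := by simp
    have := hw {i} (by simp [cliqueComplex]) (by simp)
    rw [Finset.sum_singleton] at this
    rw [← this, h3, koszulD_insert_max _ _ (by simp), koszulD_empty]
    simp [raagOp_apply]
  have hone : c 1 = 0 := by
    simpa using hc 1 1
  have hall : ∀ g, c g = ρ g (w ∅) - w ∅ := PresentedGroup.generated_by (raagRels Γ)
    { carrier := {g | c g = ρ g (w ∅) - w ∅}
      one_mem' := by simp [hone]
      mul_mem' := by
        intro a b ha hb
        simp only [Set.mem_ofPred_eq] at ha hb ⊢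
        rw [hc, ha, hb, map_sub, map_mul, Module.End.mul_apply]
        abel
      inv_mem' := by
        intro a ha
        simp only [Set.mem_ofPred_eq] at ha ⊢
        have h4 := hc a⁻¹ a
        rw [inv_mul_cancel, hone, ha, map_sub, Representation.inv_self_apply] at h4
        grind } hgen
  refine ⟨fun _ => w ∅, funext fun g => ?_⟩
  have hg : g = fun _ => g 0 := by
    ext i
    fin_cases i
    rfl
  rw [hg]
  refine Eq.trans ?_ (hall (g 0)).symm
  simp [barD, sub_eq_add_neg]

theorem barExactAt_of_koszulExactAt {n : ℕ} {Γ : SimpleGraph (Fin n)} {k : Type} [CommRing k]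
    (q : ℕ) {M : Type} [AddCommGroup M] [Module k M] (ρ : Representation k (RAAG Γ) M)
    (h : KoszulExactAt (cliqueComplex Γ) (raagOp ρ) q) : BarExactAt ρ q := by
  induction q generalizing M with
  | zero => exact barExactAt_zero_of_koszulExactAt ρ h
  | succ q ih =>
    rcases q with _ | q
    · exact barExactAt_one_of_koszulExactAt ρ h
    have hιπ : ∀ y, (LinearMap.range (toTranslation ρ)).mkQ y = 0 ↔ ∃ x, toTranslation ρ x = y :=
      fun y => by simp
    refine BarExactAt.of_shortExact (toTranslation ρ) (LinearMap.range (toTranslation ρ)).mkQ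
      (toTranslation_injective ρ) (Submodule.mkQ_surjective _) hιπ (toTranslation_rep ρ)
      (translationQuotient_mk ρ) (barExactAt_translationRep _) (ih _ ?_)
    refine KoszulExactAt.of_shortExact (T' := raagOp (translationRep k (RAAG Γ) M))
      (toTranslation ρ).toAddMonoidHom (LinearMap.range (toTranslation ρ)).mkQ.toAddMonoidHom
      (toTranslation_injective ρ) (Submodule.mkQ_surjective _) hιπ ?_ ?_ ?_ ?_ ?_ h
    · intro i x
      simp [raagOp_apply, toTranslation_rep]
    · intro i x
      exact map_sub (LinearMap.range (toTranslation ρ)).mkQ _ _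
    · exact cliqueComplex_erase
    · exact fun J hJ => raagOp_comm _ hJ
    · have := koszulExactAt_translationRep (Γ := Γ) k M Finset.univ q
      simpa only [Finset.subset_univ, and_true, Set.ofPred_mem_eq] using this

/-! ### Change of rings -/

section ChangeOfRings

variable {V : Type} [LinearOrder V] [DecidableEq V] {A B : Type} [CommRing A] [CommRing B]

/-- Exactness in degree `p` of the complex of cochains on the faces of `K` with differential
`∑ eᵢ ⊗ aᵢ`. -/
def KoszulExactOver (K : Set (Finset V)) (a : V → A) (p : ℕ) : Prop :=
  KoszulExactAt K (fun i => AddMonoid.End.mulLeft (a i)) p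

theorem koszulD_mulLeft (a : V → A) (z : Finset V → A) (J : Finset V) :
    koszulD (fun i => AddMonoid.End.mulLeft (a i)) z J =
      ∑ i ∈ J, (-1 : ℤ) ^ (J.filter (· < i)).card • (a i * z (J.erase i)) := rfl

theorem koszulD_ringHom (φ : A →+* B) (a : V → A) (z : Finset V → A) (J : Finset V) :
    koszulD (fun i => AddMonoid.End.mulLeft (φ (a i))) (fun I => φ (z I)) J =
      φ (koszulD (fun i => AddMonoid.End.mulLeft (a i)) z J) :=
  koszulD_map φ.toAddMonoidHom z J fun i _ x => map_mul φ (a i) x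

theorem koszulD_mul_left (a : V → A) (x : A) (z : Finset V → A) (J : Finset V) :
    koszulD (fun i => AddMonoid.End.mulLeft (a i)) (fun I => x * z I) J =
      x * koszulD (fun i => AddMonoid.End.mulLeft (a i)) z J :=
  koszulD_map (AddMonoidHom.mulLeft x) z J fun i _ y => mul_left_comm x (a i) y

/-- Exactness passes to the quotient by a nonzerodivisor, with a loss of one degree. -/
theorem KoszulExactOver.of_quotient {K : Set (Finset V)} {a : V → A} (φ : A →+* B)
    (hφ : Function.Surjective φ) {x : A} (hx : ∀ y, x * y = 0 → y = 0)
    (hker : ∀ y, φ y = 0 → ∃ t, x * t = y) (hφx : φ x = 0)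
    (hK : ∀ J ∈ K, ∀ i ∈ J, J.erase i ∈ K) {p : ℕ} (h0 : KoszulExactOver K a p)
    (h1 : KoszulExactOver K a (p + 1)) : KoszulExactOver K (φ ∘ a) p := by
  refine KoszulExactAt.of_shortExact (T := fun i => AddMonoid.End.mulLeft (a i))
    (T' := fun i => AddMonoid.End.mulLeft (a i)) (T'' := fun i => AddMonoid.End.mulLeft (φ (a i)))
    (AddMonoidHom.mulLeft x) φ.toAddMonoidHom
    ((injective_iff_map_eq_zero _).2 hx) hφ (fun y => ⟨hker y, ?_⟩)
    (fun i y => mul_left_comm x (a i) y) (fun i y => map_mul φ (a i) y) hK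
    (fun _ _ i _ j _ y => mul_left_comm (a i) (a j) y) h0 h1
  rintro ⟨t, rfl⟩
  exact (map_mul φ x t).trans (by rw [hφx, zero_mul])

/-- Exactness passes to localizations. -/
theorem KoszulExactOver.of_localization [Fintype V] {K : Set (Finset V)} {a : V → A} (φ : A →+* B)
    (hφ : Function.Injective φ)
    (hloc : ∀ z : Finset V → B, ∃ u v : B, v * u = 1 ∧ ∀ J, ∃ y, φ y = u * z J) {p : ℕ}
    (h : KoszulExactOver K a p) : KoszulExactOver K (φ ∘ a) p := by
  intro z hz
  obtain ⟨u, v, huv, hu⟩ := hloc z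
  choose t ht using hu
  obtain ⟨w, hw⟩ := h t fun J hJ hJp => by
    apply hφ
    rw [← koszulD_ringHom φ a t J, funext ht, koszulD_mul_left]
    exact (congrArg (u * ·) (hz J hJ hJp)).trans (by simp)
  refine ⟨fun J => v * φ (w J), fun J hJ hJp => ?_⟩
  rw [koszulD_mul_left (φ ∘ a)]
  exact (congrArg (v * ·) ((koszulD_ringHom φ a w J).trans
    ((congrArg φ (hw J hJ hJp)).trans (ht J)))).trans (by rw [← mul_assoc, huv, one_mul])

theorem KoszulExactOver.of_ringEquiv {K : Set (Finset V)} {a : V → A} (φ : A ≃+* B)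
    {p : ℕ} [Fintype V] (h : KoszulExactOver K a p) : KoszulExactOver K (φ ∘ a) p :=
  KoszulExactOver.of_localization φ.toRingHom φ.injective
    (fun z => ⟨1, 1, one_mul 1, fun J => ⟨φ.symm (z J), by simp⟩⟩) h

end ChangeOfRings

/-- Substituting variables along a surjection costs one degree for each variable lost. -/
theorem koszulExactOver_mvPolynomial (k : Type) [Field k] {n : ℕ} {K : Set (Finset (Fin n))}
    (hK : ∀ J ∈ K, ∀ i ∈ J, J.erase i ∈ K) {d : ℕ}
    (h : ∀ p ≤ d, KoszulExactOver K (fun i => (MvPolynomial.X i : MvPolynomial (Fin n) k)) p)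
    (U : Type) [Fintype U] (f : Fin n → U) (hf : Function.Surjective f) (q : ℕ)
    (hq : q + n ≤ Fintype.card U + d) :
    KoszulExactOver K (fun i => (MvPolynomial.X (f i) : MvPolynomial U k)) q := by
  obtain ⟨c, hc⟩ : ∃ c, n = Fintype.card U + c :=
    Nat.exists_eq_add_of_le (by simpa using Fintype.card_le_of_surjective f hf)
  induction c generalizing U q with
  | zero =>
    have hbij : Function.Bijective f := by
      rw [Fintype.bijective_iff_surjective_and_card]
      exact ⟨hf, by simpa using hc⟩
    have := KoszulExactOver.of_ringEquiv
      (MvPolynomial.renameEquiv k (Equiv.ofBijective f hbij)).toRingEquiv (h q (by omega))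
    convert this using 2
    simp
  | succ c ih =>
    obtain ⟨a, b, hab, hne⟩ : ∃ a b, f a = f b ∧ a ≠ b := by
      by_contra! hcon
      have := Fintype.card_le_of_injective f fun a b hab => hcon a b hab
      simp at this
      omega
    let g : Fin n → Option U := fun i => if i = b then none else some (f i)
    have hg : Function.Surjective g := by
      rintro (_ | u)
      · exact ⟨b, if_pos rfl⟩
      · obtain ⟨i, rfl⟩ := hf u
        by_cases hi : i = b
        · exact ⟨a, by simp [g, hne, hab, hi]⟩
        · exact ⟨i, if_neg hi⟩
    have hcard : Fintype.card (Option U) = Fintype.card U + 1 := Fintype.card_option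
    let ev : MvPolynomial (Option U) k →+* MvPolynomial U k :=
      (Polynomial.evalRingHom (MvPolynomial.X (f b))).comp
        (MvPolynomial.optionEquivLeft k U).toRingEquiv.toRingHom
    let x : MvPolynomial (Option U) k := (MvPolynomial.optionEquivLeft k U).symm
      (Polynomial.X - Polynomial.C (MvPolynomial.X (f b)))
    have key := KoszulExactOver.of_quotient (K := K) (a := fun i => MvPolynomial.X (g i)) ev
      (x := x) ?_ ?_ ?_ ?_ hK (ih _ g hg q (by omega) (by omega))
      (ih _ g hg (q + 1) (by omega) (by omega))
    · convert key using 2 with i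
      by_cases hi : i = b
      · simp [ev, g, hi]
      · simp [ev, g, hi]
    · intro y
      refine ⟨(MvPolynomial.optionEquivLeft k U).symm (Polynomial.C y), ?_⟩
      simp [ev]
    · intro y hy
      refine (mul_eq_zero.1 hy).resolve_left ?_
      simp only [x, EmbeddingLike.map_eq_zero_iff]
      exact Polynomial.X_sub_C_ne_zero _
    · intro y hy
      have : (MvPolynomial.optionEquivLeft k U) y ∈
          RingHom.ker (Polynomial.evalRingHom (MvPolynomial.X (f b) : MvPolynomial U k)) := hy
      rw [Polynomial.ker_evalRingHom, Ideal.mem_span_singleton] at this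
      obtain ⟨t, ht⟩ := this
      refine ⟨(MvPolynomial.optionEquivLeft k U).symm t, ?_⟩
      rw [← map_mul, ← ht, AlgEquiv.symm_apply_apply]
    · simp [ev, x]

/-- The inclusion of polynomials into Laurent polynomials. -/
def laurentOfPoly (k : Type) [Field k] (m : ℕ) : MvPolynomial (Fin m) k →+* LaurentRing k m :=
  AddMonoidAlgebra.mapDomainRingHom k
    { toFun := fun s j => (s j : ℤ)
      map_zero' := by ext; simp
      map_add' := fun s t => by ext; simp }

theorem laurentOfPoly_monomial (k : Type) [Field k] {m : ℕ} (s : Fin m →₀ ℕ) (c : k) :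
    laurentOfPoly k m (MvPolynomial.monomial s c) =
      AddMonoidAlgebra.single (fun j => (s j : ℤ)) c :=
  AddMonoidAlgebra.mapDomain_single

theorem laurentOfPoly_X (k : Type) [Field k] {m : ℕ} (j : Fin m) :
    laurentOfPoly k m (MvPolynomial.X j) = AddMonoidAlgebra.single (Pi.single j 1) 1 := by
  rw [MvPolynomial.X, laurentOfPoly_monomial]
  congr 1
  ext i
  by_cases h : i = j
  · simp [h]
  · simp [h]

theorem laurentOfPoly_injective (k : Type) [Field k] (m : ℕ) :
    Function.Injective (laurentOfPoly k m) := by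
  refine AddMonoidAlgebra.mapDomain_injective fun s t h => ?_
  ext j
  have : (s j : ℤ) = t j := congrFun h j
  exact_mod_cast this

/-- The monomial `(y₁ ⋯ yₘ) ^ N`. -/
def laurentMonomial (k : Type) [Field k] (m : ℕ) (N : ℤ) : LaurentRing k m :=
  AddMonoidAlgebra.single (fun _ => N) 1

theorem exists_laurentMonomial_mul_mem_range (k : Type) [Field k] {m : ℕ} (v : LaurentRing k m) :
    ∃ N : ℕ, ∀ N' : ℕ, N ≤ N' → ∃ y, laurentOfPoly k m y = laurentMonomial k m N' * v := by
  induction v using AddMonoidAlgebra.induction_linear with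
  | zero => exact ⟨0, fun N' _ => ⟨0, by simp⟩⟩
  | add v w hv hw =>
    obtain ⟨N, hN⟩ := hv
    obtain ⟨L, hL⟩ := hw
    refine ⟨N + L, fun N' h => ?_⟩
    obtain ⟨y, hy⟩ := hN N' (by omega)
    obtain ⟨x, hx⟩ := hL N' (by omega)
    exact ⟨y + x, by rw [map_add, hy, hx, mul_add]⟩
  | single s c =>
    refine ⟨∑ j, (s j).natAbs, fun N' h => ⟨MvPolynomial.monomial
      (Finsupp.equivFunOnFinite.symm fun j => (N' + s j).toNat) c, ?_⟩⟩
    rw [laurentOfPoly_monomial, laurentMonomial, AddMonoidAlgebra.single_mul_single, one_mul]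
    congr 1
    ext j
    have : (s j).natAbs ≤ ∑ j, (s j).natAbs :=
      Finset.single_le_sum (f := fun j => (s j).natAbs) (fun _ _ => Nat.zero_le _)
        (Finset.mem_univ j)
    simp
    omega

/-- The substitution `X_j ↦ X_j - 1`. -/
def mvPolynomialShift (k : Type) [Field k] (m : ℕ) :
    MvPolynomial (Fin m) k ≃ₐ[k] MvPolynomial (Fin m) k :=
  AlgEquiv.ofAlgHom (MvPolynomial.aeval fun j => MvPolynomial.X j - 1)
    (MvPolynomial.aeval fun j => MvPolynomial.X j + 1)
    (by ext; simp) (by ext; simp)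

theorem koszulExactOver_laurent (k : Type) [Field k] {n m : ℕ} {K : Set (Finset (Fin n))}
    {f : Fin n → Fin m} {q : ℕ}
    (h : KoszulExactOver K (fun i => (MvPolynomial.X (f i) : MvPolynomial (Fin m) k)) q) :
    KoszulExactOver K
      (fun i => (AddMonoidAlgebra.single (Pi.single (f i) 1) 1 - 1 : LaurentRing k m)) q := by
  have h1 := KoszulExactOver.of_localization (laurentOfPoly k m) (laurentOfPoly_injective k m)
    (fun z => ?_) (KoszulExactOver.of_ringEquiv (mvPolynomialShift k m).toRingEquiv h)
  · convert h1 using 2 with i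
    simp [mvPolynomialShift, laurentOfPoly_X]
  · choose N hN using fun J => exists_laurentMonomial_mul_mem_range k (z J)
    refine ⟨laurentMonomial k m (∑ J, N J : ℕ), laurentMonomial k m (-(∑ J, N J : ℕ)), ?_,
      fun J => hN J _ (Finset.single_le_sum (fun _ _ => Nat.zero_le _) (Finset.mem_univ J))⟩
    rw [laurentMonomial, laurentMonomial, AddMonoidAlgebra.single_mul_single,
      AddMonoidAlgebra.one_def]
    congr 1
    · ext
      simp
    · simp

/-! ### The Cartan complex and Laurent coefficients -/

theorem Submodule.subsingleton_map_mkQ_iff {R M : Type} [Ring R] [AddCommGroup M] [Module R M]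
    (N P : Submodule R M) : Subsingleton (N.map P.mkQ) ↔ N ≤ P := by
  rw [Submodule.subsingleton_iff_eq_bot, eq_bot_iff, Submodule.map_le_iff_le_comap,
    Submodule.comap_bot, Submodule.ker_mkQ]

theorem cartanD_eq_koszulD (k : Type) [Field k] {n : ℕ} {K : Set (Finset (Fin n))}
    (hK : ∀ J ∈ K, ∀ i ∈ J, J.erase i ∈ K) {p : ℕ} (z : Finset (Fin n) → polyRing k n)
    (J : {I : Finset (Fin n) // I ∈ K ∧ I.card = p + 1}) :
    cartanD k K p (fun I => z I.1) J =
      koszulD (fun i => AddMonoid.End.mulLeft (MvPolynomial.X i : polyRing k n)) z J.1 := by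
  rw [cartanD, LinearMap.pi_apply, LinearMap.sum_apply, koszulD_mulLeft,
    ← Finset.sum_subset (Finset.subset_univ J.1)]
  · refine Finset.sum_congr rfl fun i hi => ?_
    rw [dif_pos ⟨hi, hK J.1 J.2.1 i hi⟩, LinearMap.smul_apply]
    refine congrArg₂ (· • ·) ?_ rfl
    congr!
  · intro i _ hi
    rw [dif_neg fun h => hi h.1, LinearMap.zero_apply]

theorem koszulExactOver_of_cartan (k : Type) [Field k] {n : ℕ} {K : Set (Finset (Fin n))}
    (hK : ∀ J ∈ K, ∀ i ∈ J, J.erase i ∈ K) {p : ℕ} (h : Subsingleton (cartanCohomology k K p)) :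
    KoszulExactOver K (fun i => (MvPolynomial.X i : MvPolynomial (Fin n) k)) p := by
  intro z hz
  have hle := (Submodule.subsingleton_map_mkQ_iff _ _).1 h
  have hmem : (fun I => z I.1 : cartanTerm k K p) ∈ LinearMap.ker (cartanD k K p) := by
    rw [LinearMap.mem_ker]
    ext1 J
    rw [cartanD_eq_koszulD k hK]
    exact hz J.1 J.2.1 J.2.2
  obtain ⟨w, hw⟩ := hle hmem
  rcases p with _ | p
  · refine ⟨z, fun J hJ hJ0 => ?_⟩
    have := congrFun hw ⟨J, hJ, hJ0⟩
    rw [Finset.card_eq_zero.1 hJ0, koszulD_empty]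
    rw [Finset.card_eq_zero] at hJ0
    subst hJ0
    exact this
  · change cartanTerm k K p at w
    let w' : Finset (Fin n) → polyRing k n := fun I =>
      if h : I ∈ K ∧ I.card = p then w ⟨I, h⟩ else 0
    have hw' : w = fun I => w' I.1 := by
      ext1 I
      simp only [w', dif_pos I.2]
    refine ⟨w', fun J hJ hJp => ?_⟩
    have := congrFun hw ⟨J, hJ, hJp⟩
    rw [hw'] at this
    rw [← this]
    exact (cartanD_eq_koszulD k hK w' ⟨J, hJ, hJp⟩).symm

/-- A complex whose Cartan cohomology vanishes above degree `d + 1` has dimension at most `d`. -/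
theorem card_le_of_koszulExactOver (k : Type) [Field k] {n : ℕ} {K : Set (Finset (Fin n))} {d : ℕ}
    (h : ∀ p, d + 1 < p →
      KoszulExactOver K (fun i => (MvPolynomial.X i : MvPolynomial (Fin n) k)) p)
    {J : Finset (Fin n)} (hJ : J ∈ K) : J.card ≤ d + 1 := by
  by_contra! hcard
  obtain ⟨σ, hσ, hmax⟩ := (K.toFinite).exists_maximalFor Finset.card K ⟨J, hJ⟩
  have hle : ∀ I ∈ K, I.card ≤ σ.card := fun I hI => by
    by_contra! hlt
    exact absurd (hmax hI hlt.le) (not_le.2 hlt)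
  obtain ⟨w, hw⟩ := h σ.card (hcard.trans_le (hle J hJ)) (fun _ => 1) fun I hI hIc => by
    have := hle I hI
    omega
  have := congrArg MvPolynomial.constantCoeff (hw σ hσ rfl)
  simp [koszulD_mulLeft] at this

variable {n : ℕ} {Γ : SimpleGraph (Fin n)}

/-- The representation on Laurent polynomials through a homomorphism to `ℤᵐ`. -/
def laurentRep (k : Type) [Field k] {m : ℕ} {G : Type} [Group G]
    (φ : G →* Multiplicative (Fin m → ℤ)) : Representation k G (LaurentRing k m) where
  toFun g := LinearMap.mulLeft k (AddMonoidAlgebra.single (Multiplicative.toAdd (φ g)) 1)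
  map_one' := by
    rw [map_one, toAdd_one, ← AddMonoidAlgebra.one_def, LinearMap.mulLeft_one]
    rfl
  map_mul' g h := by
    rw [map_mul, toAdd_mul, ← one_mul (1 : k), ← AddMonoidAlgebra.single_mul_single, one_mul,
      LinearMap.mulLeft_mul]
    rfl

theorem inhomogCoD_eq_barD (k : Type) [Field k] {m : ℕ} {G : Type} [Group G]
    (φ : G →* Multiplicative (Fin m → ℤ)) (q : ℕ) (z : inhomogCochains k m G q) :
    inhomogCoD k φ q z = barD (laurentRep k φ) q z := by
  ext1 g
  rw [inhomogCoD, LinearMap.pi_apply, LinearMap.add_apply, LinearMap.sum_apply]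
  rfl

theorem subsingleton_groupCohomologyLaurent (k : Type) [Field k] {m : ℕ} {G : Type} [Group G]
    (φ : G →* Multiplicative (Fin m → ℤ)) {q : ℕ} (h : BarExactAt (laurentRep k φ) q) :
    Subsingleton (groupCohomologyLaurent k φ q) := by
  refine (Submodule.subsingleton_map_mkQ_iff _ _).2 fun z hz => ?_
  rw [LinearMap.mem_ker, inhomogCoD_eq_barD] at hz
  rcases q with _ | q
  · rw [h z hz]
    exact zero_mem _
  · obtain ⟨w, hw⟩ := h z hz
    exact ⟨w, (inhomogCoD_eq_barD k φ q w).trans hw⟩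

theorem raagOp_laurentRep (k : Type) [Field k] {m : ℕ} {f : Fin n → Fin m}
    {φ : RAAG Γ →* Multiplicative (Fin m → ℤ)}
    (hφ : ∀ i, φ (PresentedGroup.of i) = Multiplicative.ofAdd (Pi.single (f i) 1)) (i : Fin n) :
    raagOp (laurentRep k φ) i = AddMonoid.End.mulLeft
      (AddMonoidAlgebra.single (Pi.single (f i) 1) 1 - 1 : LaurentRing k m) := by
  refine AddMonoidHom.ext fun x => ?_
  have : laurentRep k φ (PresentedGroup.of i) x =
      AddMonoidAlgebra.single (Multiplicative.toAdd (φ (PresentedGroup.of i))) 1 * x := rfl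
  rw [hφ, toAdd_ofAdd] at this
  refine (raagOp_apply _ i x).trans ?_
  rw [this]
  exact (sub_one_mul _ x).symm

/-- Let `K` be the clique complex of `Γ` and suppose the
Cartan complex of `K` has cohomology concentrated in degree `d + 1`
(equivalently, `K` is Cohen–Macaulay of dimension `d`).  Then for any
surjective `f : [n] → [m]`, the group cohomology `H^q(G_Γ; k[ℤᵐ])` vanishes
for all `q ≤ m - n + d` and for all `q > d + 1`. -/
theorem groupCohomology_vanishing_of_cartan_concentrated {m : ℕ} {n : ℕ}
    (Γ : SimpleGraph (Fin n)) (d : ℕ)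
    (hvanish : ∀ p : ℕ, p ≠ d + 1 →
      Subsingleton (cartanCohomology k (cliqueComplex Γ) p))
    (f : Fin n → Fin m) (hf : Function.Surjective f)
    (φ : RAAG Γ →* Multiplicative (Fin m → ℤ))
    (hφ : ∀ i : Fin n, φ (PresentedGroup.of i) =
      Multiplicative.ofAdd (Pi.single (f i) 1)) :
    ∀ q : ℕ, ((q : ℤ) ≤ (m : ℤ) - (n : ℤ) + (d : ℤ) ∨ (d : ℤ) + 1 < (q : ℤ)) →
      Subsingleton (groupCohomologyLaurent k φ q) := by
  intro q hq
  have hcartan : ∀ p, p ≠ d + 1 →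
      KoszulExactOver (cliqueComplex Γ) (fun i => (MvPolynomial.X i : MvPolynomial (Fin n) k)) p :=
    fun p hp => koszulExactOver_of_cartan k cliqueComplex_erase (hvanish p hp)
  refine subsingleton_groupCohomologyLaurent k φ (barExactAt_of_koszulExactAt q _ ?_)
  rw [funext (raagOp_laurentRep k hφ)]
  rcases hq with hq | hq
  · refine koszulExactOver_laurent k (koszulExactOver_mvPolynomial k cliqueComplex_erase
      (d := d) (fun p hp => hcartan p (by omega)) (Fin m) f hf q ?_)
    rw [Fintype.card_fin]
    omega
  · intro z _
    refine ⟨z, fun J hJ hJq => ?_⟩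
    have := card_le_of_koszulExactOver k (fun p hp => hcartan p hp.ne') hJ
    omega
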